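/- Let β > 0, let p, q ∈ (1,∞) with p ≠ q, and let A, B ∈ (0,∞). Then the supremum of ∫₀^∞ G(v(t)) dt over v ∈ 𝒞 is finite and is attained by some u ∈ 𝒞. -/

import Mathlib

open MeasureTheory Real Set
open scoped ENNReal

noncomputable section

/-- The function `G(s) = 1 - (1 + s/(4π))^(-2β)`. -/
def GFun (β s : ℝ) : ℝ := 1 - (1 + s / (4 * π)) ^ (-(2 * β))

/-- `α_r = (r-1)/(2β+1)`. -/
def alphaC (β r : ℝ) : ℝ := (r - 1) / (2 * β + 1)

/-- `σ_r = (r-1)/(2βr+1)`. -/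
def sigmaC (β r : ℝ) : ℝ := (r - 1) / (2 * β * r + 1)

/-- The threshold `r₁ = (4π)^(1/q-1/p) (α_q/(p-α_q))^(-1/p) σ_q^(1/q)`. -/
def rOne (β p q : ℝ) : ℝ :=
  (4 * π) ^ (1 / q - 1 / p) * (alphaC β q / (p - alphaC β q)) ^ (-(1 / p)) *
    sigmaC β q ^ (1 / q)

/-- The threshold `r₂ = (4π)^(1/q-1/p) (α_p/(q-α_p))^(1/q) σ_p^(-1/p)`. -/
def rTwo (β p q : ℝ) : ℝ :=
  (4 * π) ^ (1 / q - 1 / p) * (alphaC β p / (q - alphaC β p)) ^ (1 / q) *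
    sigmaC β p ^ (-(1 / p))

/-- The admissible class `𝒞`: nonincreasing `v : (0,∞) → [0,∞)` with
`p ∫₀^∞ t^(p-1) v(t) dt ≤ A^p` and `q ∫₀^∞ t^(q-1) v(t) dt ≤ B^q`. -/
def classC (p q A B : ℝ) : Set (ℝ → ℝ) :=
  {v | (∀ t ∈ Ioi (0 : ℝ), 0 ≤ v t) ∧ AntitoneOn v (Ioi 0) ∧
    ENNReal.ofReal p * ∫⁻ t in Ioi (0 : ℝ), ENNReal.ofReal (t ^ (p - 1) * v t) ≤
      ENNReal.ofReal (A ^ p) ∧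
    ENNReal.ofReal q * ∫⁻ t in Ioi (0 : ℝ), ENNReal.ofReal (t ^ (q - 1) * v t) ≤
      ENNReal.ofReal (B ^ q)}

/-- The objective functional `v ↦ ∫₀^∞ G(v(t)) dt` (as an extended-real integral). -/
def varObj (β : ℝ) (v : ℝ → ℝ) : ℝ≥0∞ :=
  ∫⁻ t in Ioi (0 : ℝ), ENNReal.ofReal (GFun β (v t))

open Filter Topology

/-- Helly's selection theorem: a sequence of antitone functions with values in a complete linear
order has a subsequence converging outside a countable set. -/
theorem exists_subseq_tendsto_liminf_of_antitone {α : Type*} [CompleteLinearOrder α]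
    [TopologicalSpace α] [OrderTopology α] [SecondCountableTopology α]
    (f : ℕ → ℝ → α) (hf : ∀ n, Antitone (f n)) :
    ∃ φ : ℕ → ℕ, StrictMono φ ∧ {t | ¬ Tendsto (fun n => f (φ n) t) atTop
      (𝓝 (liminf (fun n => f (φ n) t) atTop))}.Countable := by
  obtain ⟨L, -, φ, hφ, hL⟩ := (isCompact_univ (X := ℚ → α)).tendsto_subseq
    (x := fun n (r : ℚ) => f n r) (fun n => mem_univ _)
  rw [tendsto_pi_nhds] at hL
  set g : ℝ → α := fun t => liminf (fun n => f (φ n) t) atTop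
  have hanti : Antitone g := fun s t hst =>
    liminf_le_liminf (Eventually.of_forall fun n => hf (φ n) hst)
  refine ⟨φ, hφ, hanti.countable_not_continuousAt.mono ?_⟩
  intro t ht hc
  refine ht ?_
  refine tendsto_of_le_liminf_of_limsup_le le_rfl ?_
  by_contra! hlt
  have hev : ∀ᶠ s in 𝓝 t, g s < limsup (fun n => f (φ n) t) atTop := hc.eventually_lt_const hlt
  obtain ⟨a, ha, haI⟩ := exists_Ioc_subset_of_mem_nhds hev (exists_lt t)
  obtain ⟨r, har, hrt⟩ := exists_rat_btwn ha
  have h1 : g r < limsup (fun n => f (φ n) t) atTop := haI ⟨har, hrt.le⟩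
  have h2 : limsup (fun n => f (φ n) t) atTop ≤ limsup (fun n => f (φ n) r) atTop :=
    limsup_le_limsup (Eventually.of_forall fun n => hf (φ n) hrt.le)
  have h3 : g r = L r := (hL r).liminf_eq
  have h4 : limsup (fun n => f (φ n) r) atTop = L r := (hL r).limsup_eq
  exact (h1.trans_le (h2.trans (h4.trans h3.symm).le)).false

/-- Helly's selection theorem for nonnegative antitone functions on `(0, ∞)` with a common finite
pointwise bound. -/
theorem exists_subseq_ae_tendsto_of_antitoneOn (v : ℕ → ℝ → ℝ) (C : ℝ → ℝ)
    (hnn : ∀ n, ∀ t ∈ Ioi (0 : ℝ), 0 ≤ v n t) (hanti : ∀ n, AntitoneOn (v n) (Ioi 0))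
    (hC : ∀ n, ∀ t ∈ Ioi (0 : ℝ), v n t ≤ C t) :
    ∃ (φ : ℕ → ℕ) (u : ℝ → ℝ), StrictMono φ ∧ (∀ t, 0 ≤ u t) ∧ AntitoneOn u (Ioi 0) ∧
      ∀ᵐ t ∂(volume.restrict (Ioi (0 : ℝ))), Tendsto (fun n => v (φ n) t) atTop (𝓝 (u t)) := by
  set f : ℕ → ℝ → ℝ≥0∞ := fun n t => if t ≤ 0 then ⊤ else ENNReal.ofReal (v n t) with hf
  have hpos : ∀ n, ∀ t ∈ Ioi (0 : ℝ), f n t = ENNReal.ofReal (v n t) := fun n t ht =>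
    if_neg (not_le.2 ht)
  have hfa : ∀ n, Antitone (f n) := by
    intro n s t hst
    rcases le_or_gt s 0 with hs | hs
    · simp [hf, hs]
    · rw [hpos n s hs, hpos n t (hs.trans_le hst)]
      exact ENNReal.ofReal_le_ofReal (hanti n hs (hs.trans_le hst) hst)
  obtain ⟨φ, hmono, hφ⟩ := exists_subseq_tendsto_liminf_of_antitone f hfa
  set g : ℝ → ℝ≥0∞ := fun t => liminf (fun n => f (φ n) t) atTop
  have hgC : ∀ t ∈ Ioi (0 : ℝ), g t ≠ ⊤ := by
    intro t ht
    have : g t ≤ liminf (fun _ : ℕ => ENNReal.ofReal (C t)) atTop :=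
      liminf_le_liminf (Eventually.of_forall fun n => by
        change f (φ n) t ≤ _
        rw [hpos _ t ht]
        exact ENNReal.ofReal_le_ofReal (hC _ t ht))
    rw [liminf_const] at this
    exact ne_top_of_le_ne_top ENNReal.ofReal_ne_top this
  refine ⟨φ, fun t => (g t).toReal, hmono, fun t => ENNReal.toReal_nonneg, ?_, ?_⟩
  · intro s hs t ht hst
    exact ENNReal.toReal_mono (hgC s hs)
      (liminf_le_liminf (Eventually.of_forall fun n => hfa (φ n) hst))
  · filter_upwards [ae_restrict_mem measurableSet_Ioi,
      ae_restrict_of_ae (hφ.ae_notMem volume)] with t ht hlim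
    have h := (ENNReal.tendsto_toReal (hgC t ht)).comp (not_not.1 hlim)
    refine h.congr fun n => ?_
    simp only [Function.comp_apply, hpos _ t ht, ENNReal.toReal_ofReal (hnn _ t ht)]

theorem GFun_le_one {β s : ℝ} (hs : 0 ≤ s) : GFun β s ≤ 1 := by
  have : 0 ≤ (1 + s / (4 * π)) ^ (-(2 * β)) := by positivity
  unfold GFun
  linarith

theorem GFun_le_mul {β s : ℝ} (hβ : 0 ≤ β) (hs : 0 ≤ s) : GFun β s ≤ 2 * β * (s / (4 * π)) := by
  unfold GFun
  have hx : 0 ≤ s / (4 * π) := by positivity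
  set x := s / (4 * π)
  rw [Real.rpow_def_of_pos (by linarith)]
  have h1 := Real.add_one_le_exp (Real.log (1 + x) * (-(2 * β)))
  have h2 := Real.log_le_sub_one_of_pos (show 0 < 1 + x by linarith)
  nlinarith

theorem continuousAt_GFun {β s : ℝ} (hs : 0 ≤ s) : ContinuousAt (GFun β) s := by
  have : 1 + s / (4 * π) ≠ 0 := by positivity
  unfold GFun
  exact continuousAt_const.sub (ContinuousAt.rpow_const (by fun_prop) (Or.inl this))

theorem measurable_GFun (β : ℝ) : Measurable (GFun β) := by
  unfold GFun
  fun_prop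

/-- The weighted integral constraint bounds an antitone function pointwise. -/
theorem le_mul_rpow_neg_of_lintegral_le {p M : ℝ} {v : ℝ → ℝ} (hp : 0 < p) (hM : 0 ≤ M)
    (hnn : ∀ t ∈ Ioi (0 : ℝ), 0 ≤ v t) (hanti : AntitoneOn v (Ioi 0))
    (hint : ENNReal.ofReal p * ∫⁻ t in Ioi (0 : ℝ), ENNReal.ofReal (t ^ (p - 1) * v t) ≤
      ENNReal.ofReal M) {t : ℝ} (ht : 0 < t) : v t ≤ M * t ^ (-p) := by
  have hvt := hnn t ht
  have hle : ENNReal.ofReal (t ^ p / p * v t) ≤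
      ∫⁻ s in Ioi (0 : ℝ), ENNReal.ofReal (s ^ (p - 1) * v s) := by
    have hi : IntervalIntegrable (fun s : ℝ => s ^ (p - 1) * v t) volume 0 t :=
      (intervalIntegral.intervalIntegrable_rpow' (by linarith)).mul_const _
    have hI : ∫ s in Ioc 0 t, s ^ (p - 1) * v t = t ^ p / p * v t := by
      rw [← intervalIntegral.integral_of_le ht.le, intervalIntegral.integral_mul_const,
        integral_rpow (Or.inl (by linarith))]
      simp [Real.zero_rpow hp.ne']
    rw [← hI, ofReal_integral_eq_lintegral_ofReal]
    · refine (setLIntegral_mono' measurableSet_Ioc fun s hs => ENNReal.ofReal_le_ofReal ?_).trans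
        (lintegral_mono_set Ioc_subset_Ioi_self)
      exact mul_le_mul_of_nonneg_left (hanti hs.1 ht hs.2) (Real.rpow_nonneg hs.1.le _)
    · exact (intervalIntegrable_iff_integrableOn_Ioc_of_le ht.le).1 hi
    · filter_upwards [ae_restrict_mem measurableSet_Ioc] with s hs
      exact mul_nonneg (Real.rpow_nonneg hs.1.le _) hvt
  have h := (mul_le_mul_right hle (ENNReal.ofReal p)).trans hint
  rw [← ENNReal.ofReal_mul hp.le, ENNReal.ofReal_le_ofReal_iff hM] at h
  have htp := Real.rpow_pos_of_pos ht p
  rw [Real.rpow_neg ht.le, ← div_eq_mul_inv, le_div_iff₀ htp]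
  calc v t * t ^ p = p * (t ^ p / p * v t) := by field_simp
    _ ≤ M := h

/-- The weighted integral constraint passes to almost everywhere limits. -/
theorem mul_lintegral_le_of_ae_tendsto {r : ℝ} {c M : ℝ≥0∞} (hc : c ≠ ⊤) {v : ℕ → ℝ → ℝ}
    {u : ℝ → ℝ} (hanti : ∀ n, AntitoneOn (v n) (Ioi 0))
    (hlim : ∀ᵐ t ∂(volume.restrict (Ioi (0 : ℝ))), Tendsto (fun n => v n t) atTop (𝓝 (u t)))
    (hint : ∀ n, c * ∫⁻ t in Ioi (0 : ℝ), ENNReal.ofReal (t ^ r * v n t) ≤ M) :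
    c * ∫⁻ t in Ioi (0 : ℝ), ENNReal.ofReal (t ^ r * u t) ≤ M := by
  have hmeas : ∀ n, AEMeasurable (fun t => c * ENNReal.ofReal (t ^ r * v n t))
      (volume.restrict (Ioi (0 : ℝ))) := fun n =>
    ((AEMeasurable.mul (by fun_prop)
      (aemeasurable_restrict_of_antitoneOn measurableSet_Ioi (hanti n))).ennreal_ofReal).const_mul c
  calc c * ∫⁻ t in Ioi (0 : ℝ), ENNReal.ofReal (t ^ r * u t)
      = ∫⁻ t in Ioi (0 : ℝ), c * ENNReal.ofReal (t ^ r * u t) :=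
        (lintegral_const_mul' _ _ hc).symm
    _ = ∫⁻ t in Ioi (0 : ℝ), liminf (fun n => c * ENNReal.ofReal (t ^ r * v n t)) atTop := by
        refine lintegral_congr_ae ?_
        filter_upwards [hlim] with t ht
        exact (ENNReal.Tendsto.const_mul (ENNReal.tendsto_ofReal (ht.const_mul _))
          (Or.inr hc)).liminf_eq.symm
    _ ≤ liminf (fun n => ∫⁻ t in Ioi (0 : ℝ), c * ENNReal.ofReal (t ^ r * v n t)) atTop :=
        lintegral_liminf_le' hmeas
    _ ≤ liminf (fun _ : ℕ => M) atTop := liminf_le_liminf (Eventually.of_forall fun n => by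
        change ∫⁻ t in Ioi (0 : ℝ), c * ENNReal.ofReal (t ^ r * v n t) ≤ M
        rw [lintegral_const_mul' _ _ hc]
        exact hint n)
    _ = M := liminf_const M

/-- The objective integrands over `classC` share an integrable majorant. -/
theorem exists_lintegral_ne_top_bound (β p A : ℝ) (hβ : 0 ≤ β) (hp : 1 < p) (hA : 0 ≤ A) :
    ∃ b : ℝ → ℝ≥0∞, ∫⁻ t in Ioi (0 : ℝ), b t ≠ ⊤ ∧ ∀ q B : ℝ, ∀ v ∈ classC p q A B,
      ∀ t ∈ Ioi (0 : ℝ), ENNReal.ofReal (GFun β (v t)) ≤ b t := by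
  set K : ℝ := 2 * β * A ^ p / (4 * π)
  refine ⟨fun t => if t ≤ 1 then 1 else ENNReal.ofReal (t ^ (-p) * K), ?_, ?_⟩
  · rw [← Ioc_union_Ioi_eq_Ioi zero_le_one]
    refine ne_top_of_le_ne_top (ENNReal.add_ne_top.2 ⟨?_, ?_⟩) (lintegral_union_le _ _ _)
    · rw [setLIntegral_congr_fun measurableSet_Ioc (g := fun _ => 1) fun t ht => if_pos ht.2]
      simp
    · rw [setLIntegral_congr_fun measurableSet_Ioi (g := fun t => ENNReal.ofReal (t ^ (-p) * K))
        fun t ht => if_neg (not_le.2 ht)]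
      exact ((integrableOn_Ioi_rpow_of_lt (by linarith) one_pos).mul_const K).lintegral_lt_top.ne
  · rintro q B v ⟨hnn, hanti, hint, -⟩ t ht
    have hv := le_mul_rpow_neg_of_lintegral_le (by linarith) (by positivity) hnn hanti hint ht
    beta_reduce
    split_ifs
    · simpa using ENNReal.ofReal_le_ofReal (GFun_le_one (β := β) (hnn t ht))
    · refine ENNReal.ofReal_le_ofReal ((GFun_le_mul hβ (hnn t ht)).trans ?_)
      calc 2 * β * (v t / (4 * π)) ≤ 2 * β * (A ^ p * t ^ (-p) / (4 * π)) := by gcongr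
        _ = t ^ (-p) * K := by ring

/-- For any `β > 0`, `p, q ∈ (1,∞)` with `p ≠ q` and `A, B > 0`, the
supremum of `∫₀^∞ G(v(t)) dt` over `v ∈ 𝒞` is finite and attained by some `u ∈ 𝒞`. -/
theorem variational_problem_attained
    (β p q A B : ℝ) (hβ : 0 < β)
    (hp : 1 < p) (hq : 1 < q) (hpq : p ≠ q) (hA : 0 < A) (hB : 0 < B) :
    ∃ u ∈ classC p q A B, varObj β u < ⊤ ∧ ∀ v ∈ classC p q A B, varObj β v ≤ varObj β u := by
  obtain ⟨b, hb, hbound⟩ := exists_lintegral_ne_top_bound β p A hβ.le hp hA.le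
  have hzero : (fun _ => 0 : ℝ → ℝ) ∈ classC p q A B :=
    ⟨fun _ _ => le_rfl, antitoneOn_const, by simp, by simp⟩
  obtain ⟨w, -, hwlim, hw⟩ := exists_seq_tendsto_sSup
    (S := varObj β '' classC p q A B) ⟨_, mem_image_of_mem _ hzero⟩ (OrderTop.bddAbove _)
  choose v hv hvw using hw
  obtain ⟨φ, u, hφ, hu0, huanti, hlim⟩ := exists_subseq_ae_tendsto_of_antitoneOn v
    (fun t => A ^ p * t ^ (-p)) (fun n => (hv n).1) (fun n => (hv n).2.1) fun n t ht =>
      le_mul_rpow_neg_of_lintegral_le (by linarith) (by positivity) (hv n).1 (hv n).2.1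
        (hv n).2.2.1 ht
  have hu : u ∈ classC p q A B := ⟨fun t _ => hu0 t, huanti,
    mul_lintegral_le_of_ae_tendsto ENNReal.ofReal_ne_top (fun n => (hv (φ n)).2.1) hlim
      fun n => (hv (φ n)).2.2.1,
    mul_lintegral_le_of_ae_tendsto ENNReal.ofReal_ne_top (fun n => (hv (φ n)).2.1) hlim
      fun n => (hv (φ n)).2.2.2⟩
  have hconv : Tendsto (fun n => varObj β (v (φ n))) atTop (𝓝 (varObj β u)) := by
    refine tendsto_lintegral_of_dominated_convergence' b (fun n => ?_) (fun n => ?_) hb ?_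
    · exact ((measurable_GFun β).comp_aemeasurable
        (aemeasurable_restrict_of_antitoneOn measurableSet_Ioi (hv (φ n)).2.1)).ennreal_ofReal
    · filter_upwards [ae_restrict_mem measurableSet_Ioi] with t ht
      exact hbound q B _ (hv (φ n)) t ht
    · filter_upwards [hlim] with t ht
      exact ENNReal.tendsto_ofReal ((continuousAt_GFun (hu0 t)).tendsto.comp ht)
  have hsup : varObj β u = sSup (varObj β '' classC p q A B) :=
    tendsto_nhds_unique hconv ((hwlim.comp hφ.tendsto_atTop).congr fun n => (hvw (φ n)).symm)
  refine ⟨u, hu, ?_, fun v' hv' => hsup ▸ le_sSup (mem_image_of_mem _ hv')⟩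
  exact (setLIntegral_mono' measurableSet_Ioi (hbound q B u hu)).trans_lt hb.lt_top

end
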